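/- Let {ρ_i}_{i∈ℤ^d} satisfy λ_i(ρ_i ∣ ω) = 1 for all i and ω, together with hypotheses (H1) and (H2), and assume λ^i(E) = 1 for every i ∈ ℤ^d. Let {ρ_Λ}_{Λ∈𝒮} be the constructed family making {ρ_Λ λ_Λ}_{Λ∈𝒮} a specification with ρ_{{i}} = ρ_i. Let 𝒩 be the set of probability measures μ on (Ω,𝓕) such that (μ λ_j)(B(j,V)^c) = 0 for every finite V ⊆ ℤ^d and j ∉ V. Then, within 𝒩, consistency with the full specification is equivalent to consistency with the singletons: 𝒩 ∩ 𝒢({ρ_Λ λ_Λ}_{Λ∈𝒮}) = 𝒩 ∩ {μ probability measure on (Ω,𝓕) : μ(ρ_i λ_i) = μ for all i ∈ ℤ^d}. -/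

import Mathlib

open MeasureTheory ProbabilityTheory
open scoped ENNReal NNReal

namespace GibbsSingleton

/-- Configuration space `E^ι`. -/
abbrev Config (ι E : Type*) := ι → E

variable {ι E : Type*}

/-- The configuration equal to `σ` on `Λ` and to `ω` off `Λ`. -/
def subst [DecidableEq ι] (Λ : Finset ι) (σ : {x // x ∈ Λ} → E) (ω : Config ι E) :
    Config ι E := fun i => if h : i ∈ Λ then σ ⟨i, h⟩ else ω i

variable [MeasurableSpace E]

/-- The free kernel `λ_Λ` applied to an `ℝ≥0∞`-valued function:
`λ_Λ(h ∣ ω) = ∫ h(σ_Λ ω) λ^Λ(dσ_Λ)`. -/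
noncomputable def freeF [DecidableEq ι] (lam : ι → Measure E) (Λ : Finset ι)
    (h : Config ι E → ℝ≥0∞) (ω : Config ι E) : ℝ≥0∞ :=
  ∫⁻ σ : {x // x ∈ Λ} → E, h (subst Λ σ ω) ∂(Measure.pi fun i : {x // x ∈ Λ} => lam i.1)

/-- The function `ρ_i ρ_j⁻¹`, `ℝ≥0∞`-valued. -/
noncomputable def rat (ρ : ι → Config ι E → ℝ≥0) (i j : ι) (η : Config ι E) : ℝ≥0∞ :=
  (ρ i η : ℝ≥0∞) / (ρ j η : ℝ≥0∞)

/-- The set `b(j,V,ω)` of good configurations at site `j` given `ω` outside `V ∪ {j}`. -/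
noncomputable def bSet [DecidableEq ι] (lam : ι → Measure E) (ρ : ι → Config ι E → ℝ≥0)
    (j : ι) (V : Finset ι) (ω : Config ι E) : Set E :=
  {x | (∀ σ : {y // y ∈ V} → E, 0 < ρ j (subst V σ (Function.update ω j x))) ∧
    ∀ i, i ≠ j →
      0 < (⨅ σ : {y // y ∈ V} → E,
          freeF lam {i} (rat ρ i j) (subst V σ (Function.update ω j x))) ∧
      (⨆ σ : {y // y ∈ V} → E,
          freeF lam {i} (rat ρ i j) (subst V σ (Function.update ω j x))) < ⊤}

/-- The multi-site good set `b(V,W,ω)`. -/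
noncomputable def bSetF [DecidableEq ι] (lam : ι → Measure E) (ρ : ι → Config ι E → ℝ≥0)
    (V W : Finset ι) (ω : Config ι E) : Set ({x // x ∈ V} → E) :=
  {xV | ∀ k : {x // x ∈ V}, xV k ∈ bSet lam ρ k.1 ((V.erase k.1) ∪ W) ω}

/-- The set `B(j,V) = {ω : ω_j ∈ b(j,V,ω)}`. -/
noncomputable def BSet [DecidableEq ι] (lam : ι → Measure E) (ρ : ι → Config ι E → ℝ≥0)
    (j : ι) (V : Finset ι) : Set (Config ι E) :=
  {ω | ω j ∈ bSet lam ρ j V ω}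

/-- Hypothesis (H1): every good set `b(j,V,ω)` is nonempty. -/
def H1 [DecidableEq ι] (lam : ι → Measure E) (ρ : ι → Config ι E → ℝ≥0) : Prop :=
  ∀ (ω : Config ι E) (j : ι) (V : Finset ι), j ∉ V → (bSet lam ρ j V ω).Nonempty

/-- The order-consistency identity appearing in hypothesis (H2), with the convention
`1/∞ = 0` built into `ℝ≥0∞` division. -/
def H2id [DecidableEq ι] (lam : ι → Measure E) (ρ : ι → Config ι E → ℝ≥0)
    (i j : ι) (ω : Config ι E) : Prop :=
  ∀ xi ∈ bSet lam ρ i {j} ω, ∀ xj ∈ bSet lam ρ j {i} ω,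
    ((ρ i ω : ℝ≥0∞) * (ρ j (Function.update ω i xi) : ℝ≥0∞)) /
      ((ρ i (Function.update ω i xi) : ℝ≥0∞) *
        freeF lam {j} (rat ρ j i) (Function.update ω i xi))
    = ((ρ j ω : ℝ≥0∞) * (ρ i (Function.update ω j xj) : ℝ≥0∞)) /
      ((ρ j (Function.update ω j xj) : ℝ≥0∞) *
        freeF lam {i} (rat ρ i j) (Function.update ω j xj))

/-- Hypothesis (H2). -/
def H2 [DecidableEq ι] (lam : ι → Measure E) (ρ : ι → Config ι E → ℝ≥0) : Prop :=
  ∀ i j, i ≠ j → ∀ ω : Config ι E, H2id lam ρ i j ω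

/-- `R_Θ^Γ` evaluated using the choice `x_Θ`:
`((ρ_Θ/ρ_Γ) ⬝ λ_Γ(ρ_Γ ρ_Θ⁻¹))(x_Θ ω)`. -/
noncomputable def Rexpr [DecidableEq ι] (lam : ι → Measure E)
    (ρF : Finset ι → Config ι E → ℝ≥0) (Θ Γ : Finset ι) (x : {y // y ∈ Θ} → E)
    (ω : Config ι E) : ℝ≥0∞ :=
  ((ρF Θ (subst Θ x ω) : ℝ≥0∞) / (ρF Γ (subst Θ x ω) : ℝ≥0∞)) *
    freeF lam Γ (fun η => (ρF Γ η : ℝ≥0∞) / (ρF Θ η : ℝ≥0∞)) (subst Θ x ω)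

/-- The family `ρ_Λ` is obtained from the singletons `ρ_i` by the recursive construction
`ρ_{Λ∪{i}} = ρ_Λ / R_Λ^i`, `R_Λ^i(ω) = ((ρ_Λ/ρ_i) ⬝ λ_i(ρ_i ρ_Λ⁻¹))(x_Λ ω)`,
`x_Λ ∈ b(Λ,{i},ω)` (the value being independent of this choice). -/
def IsRec [DecidableEq ι] (lam : ι → Measure E) (ρ : ι → Config ι E → ℝ≥0)
    (ρF : Finset ι → Config ι E → ℝ≥0) : Prop :=
  (∀ ω, ρF ∅ ω = 1) ∧ (∀ i, ρF {i} = ρ i) ∧ (∀ Λ, Measurable (ρF Λ)) ∧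
  ∀ (Λ : Finset ι) (i : ι), i ∉ Λ → ∀ ω : Config ι E,
    (∀ x ∈ bSetF lam ρ Λ {i} ω, ∀ x' ∈ bSetF lam ρ Λ {i} ω,
      Rexpr lam ρF Λ {i} x ω = Rexpr lam ρF Λ {i} x' ω) ∧
    ∀ x ∈ bSetF lam ρ Λ {i} ω,
      (ρF (insert i Λ) ω : ℝ≥0∞) = (ρF Λ ω : ℝ≥0∞) / Rexpr lam ρF Λ {i} x ω

/-- The sub-σ-algebra `𝓕_U` of events generated by the coordinates in `U`. -/
def cylSigma (E : Type*) [MeasurableSpace E] {ι : Type*} (U : Set ι) :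
    MeasurableSpace (Config ι E) :=
  MeasurableSpace.comap (fun ω (i : U) => ω i.1) MeasurableSpace.pi

/-- A specification: a family of probability kernels, measurable w.r.t. the outside
σ-algebra, proper, and consistent. -/
def IsSpecification (γ : Finset ι → Kernel (Config ι E) (Config ι E)) : Prop :=
  (∀ Λ, IsMarkovKernel (γ Λ)) ∧
  (∀ (Λ : Finset ι) (A : Set (Config ι E)), MeasurableSet A →
    Measurable[cylSigma E ((Λ : Set ι)ᶜ)] fun ω => γ Λ ω A) ∧
  (∀ (Λ : Finset ι) (B : Set (Config ι E)), MeasurableSet[cylSigma E ((Λ : Set ι)ᶜ)] B →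
    ∀ ω, γ Λ ω B = B.indicator (fun _ => (1 : ℝ≥0∞)) ω) ∧
  (∀ Λ Δ : Finset ι, Λ ⊆ Δ → (γ Λ).comp (γ Δ) = γ Δ)

/-- The kernel family `γ` is `{ρ_Λ λ_Λ}`. -/
def MatchesDensity [DecidableEq ι] (lam : ι → Measure E)
    (γ : Finset ι → Kernel (Config ι E) (Config ι E))
    (ρF : Finset ι → Config ι E → ℝ≥0) : Prop :=
  ∀ (Λ : Finset ι) (ω : Config ι E) (A : Set (Config ι E)), MeasurableSet A →
    γ Λ ω A = freeF lam Λ (fun η => (ρF Λ η : ℝ≥0∞) * A.indicator (fun _ => 1) η) ω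

end GibbsSingleton

namespace GibbsSingleton

section Helpers

set_option linter.unusedSectionVars false

variable {ι E : Type*} [DecidableEq ι] [MeasurableSpace E]

theorem freeF_eq (lam : ι → Measure E) (Λ : Finset ι) (h : Config ι E → ℝ≥0∞) :
    freeF lam Λ h = lmarginal lam Λ h := rfl

theorem freeF_single (lam : ι → Measure E) [∀ i, IsProbabilityMeasure (lam i)] (i : ι)
    (h : Config ι E → ℝ≥0∞) (ω : Config ι E) :
    freeF lam {i} h ω = ∫⁻ s, h (Function.update ω i s) ∂lam i := by
  rw [freeF_eq, lmarginal_singleton]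

theorem freeF_insert (lam : ι → Measure E) [∀ i, IsProbabilityMeasure (lam i)]
    {Λ : Finset ι} {i : ι} (hi : i ∉ Λ)
    {h : Config ι E → ℝ≥0∞} (hh : Measurable h) :
    freeF lam (insert i Λ) h = freeF lam Λ (freeF lam {i} h) := by
  rw [freeF_eq, freeF_eq, freeF_eq, lmarginal_insert' _ hh hi, lmarginal_singleton]

theorem measurable_freeF (lam : ι → Measure E) [∀ i, IsProbabilityMeasure (lam i)]
    {Λ : Finset ι} {h : Config ι E → ℝ≥0∞} (hh : Measurable h) :
    Measurable (freeF lam Λ h) := by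
  rw [freeF_eq]; exact hh.lmarginal _

/-- `η` agrees with `ω` off `V`. -/
def Agree (V : Finset ι) (ω η : Config ι E) : Prop := ∀ i, i ∉ V → η i = ω i

theorem agree_iff {V : Finset ι} {ω η : Config ι E} :
    Agree V ω η ↔ ∃ σ : {y // y ∈ V} → E, subst V σ ω = η := by
  constructor
  · intro h
    refine ⟨fun y => η y.1, ?_⟩
    funext i
    by_cases hi : i ∈ V
    · simp [subst, hi]
    · simp [subst, hi, h i hi]
  · rintro ⟨σ, rfl⟩ i hi
    simp [subst, hi]

theorem mem_bSet_iff {lam : ι → Measure E} {ρ : ι → Config ι E → ℝ≥0} {j : ι} {V : Finset ι}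
    {ω : Config ι E} {x : E} :
    x ∈ bSet lam ρ j V ω ↔ (∀ η, Agree V (Function.update ω j x) η → 0 < ρ j η) ∧
      ∀ i, i ≠ j → ∃ m M : ℝ≥0∞, 0 < m ∧ M < ⊤ ∧ ∀ η, Agree V (Function.update ω j x) η →
        m ≤ freeF lam {i} (rat ρ i j) η ∧ freeF lam {i} (rat ρ i j) η ≤ M := by
  unfold bSet
  simp only [Set.mem_ofPred_eq]
  refine and_congr ?_ (forall_congr' fun i => imp_congr_right fun _ => ?_)
  · constructor
    · intro h η hη
      obtain ⟨σ, rfl⟩ := agree_iff.1 hη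
      exact h σ
    · intro h σ
      exact h _ (agree_iff.2 ⟨σ, rfl⟩)
  · constructor
    · rintro ⟨h1, h2⟩
      refine ⟨_, _, h1, h2, ?_⟩
      intro η hη
      obtain ⟨σ, rfl⟩ := agree_iff.1 hη
      exact ⟨iInf_le _ σ, le_iSup (fun σ : {y // y ∈ V} → E =>
        freeF lam {i} (rat ρ i j) (subst V σ (Function.update ω j x))) σ⟩
    · rintro ⟨m, M, hm, hM, h⟩
      exact ⟨lt_of_lt_of_le hm (le_iInf fun σ => (h _ (agree_iff.2 ⟨σ, rfl⟩)).1),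
        lt_of_le_of_lt (iSup_le fun σ => (h _ (agree_iff.2 ⟨σ, rfl⟩)).2) hM⟩

theorem bSet_mono {lam : ι → Measure E} {ρ : ι → Config ι E → ℝ≥0} {j : ι} {V V' : Finset ι}
    {ω η : Config ι E} (hV : V ⊆ V') (hη : ∀ i, i ∉ V' → i ≠ j → η i = ω i) {x : E}
    (hx : x ∈ bSet lam ρ j V' ω) : x ∈ bSet lam ρ j V η := by
  rw [mem_bSet_iff] at hx ⊢
  have key : ∀ ζ, Agree V (Function.update η j x) ζ → Agree V' (Function.update ω j x) ζ := by
    intro ζ hζ i hi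
    rw [hζ i (fun h => hi (hV h))]
    by_cases hij : i = j
    · subst hij; simp
    · simp [hij, hη i hi hij]
  refine ⟨fun ζ hζ => hx.1 ζ (key ζ hζ), fun i hi => ?_⟩
  obtain ⟨m, M, hm, hM, h⟩ := hx.2 i hi
  exact ⟨m, M, hm, hM, fun ζ hζ => h ζ (key ζ hζ)⟩

theorem bSetF_nonempty {lam : ι → Measure E} {ρ : ι → Config ι E → ℝ≥0} (h1 : H1 lam ρ)
    {Λ : Finset ι} {i : ι} (hi : i ∉ Λ) (ω : Config ι E) :
    ∃ x, x ∈ bSetF lam ρ Λ {i} ω := by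
  have : ∀ k : {x // x ∈ Λ}, ∃ x, x ∈ bSet lam ρ k.1 ((Λ.erase k.1) ∪ {i}) ω := by
    intro k
    apply h1
    have : k.1 ≠ i := fun h => hi (h ▸ k.2)
    simp [this]
  choose x hx using this
  exact ⟨x, hx⟩

theorem bSetF_congr {lam : ι → Measure E} {ρ : ι → Config ι E → ℝ≥0}
    {Λ W : Finset ι} {ω η : Config ι E} (h : Agree (Λ ∪ W) ω η) {x : {x // x ∈ Λ} → E}
    (hx : x ∈ bSetF lam ρ Λ W ω) : x ∈ bSetF lam ρ Λ W η := by
  intro k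
  refine bSet_mono (Finset.Subset.refl _) ?_ (hx k)
  intro i hi hik
  apply h
  simp only [Finset.mem_union, Finset.mem_erase, not_or, not_and] at hi ⊢
  exact ⟨hi.1 hik, hi.2⟩

theorem subst_self (Λ : Finset ι) (ω : Config ι E) : subst Λ (fun k => ω k.1) ω = ω := by
  funext i
  by_cases hi : i ∈ Λ <;> simp [subst, hi]

theorem div_aux {a b g : ℝ≥0∞} (ha : a ≠ 0) (ha' : a ≠ ⊤) (hb : b ≠ 0) (hb' : b ≠ ⊤) :
    a / (a / b * g) = b / g := by
  rw [div_eq_mul_inv, ENNReal.mul_inv, ENNReal.inv_div, ← mul_assoc, div_eq_mul_inv b a,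
    mul_comm b, ← mul_assoc, ENNReal.mul_inv_cancel ha ha', one_mul, div_eq_mul_inv]
  · left; exact hb'
  · left; exact hb
  · left; exact (ENNReal.div_pos ha hb').ne'
  · left; exact ENNReal.div_ne_top ha' hb

/-- Pointwise bounds on the good set. -/
theorem good_bounds {lam : ι → Measure E} [∀ i, IsProbabilityMeasure (lam i)]
    {ρ : ι → Config ι E → ℝ≥0} (hmeas : ∀ i, Measurable (ρ i))
    (hnorm : ∀ (i : ι) (ω : Config ι E), freeF lam {i} (fun η => (ρ i η : ℝ≥0∞)) ω = 1)
    {ρF : Finset ι → Config ι E → ℝ≥0} (hrec : IsRec lam ρ ρF) (Λ : Finset ι) :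
    ∀ (W : Finset ι) (ω : Config ι E),
      (∀ k ∈ Λ, ω k ∈ bSet lam ρ k (Λ.erase k ∪ W) ω) → Disjoint Λ W →
      (∀ η, Agree W ω η → 0 < ρF Λ η) ∧
      ∀ i ∈ W, ∃ m M : ℝ≥0∞, 0 < m ∧ M < ⊤ ∧ ∀ η, Agree W ω η →
        m ≤ freeF lam {i} (fun η => (ρ i η : ℝ≥0∞) / (ρF Λ η : ℝ≥0∞)) η ∧
        freeF lam {i} (fun η => (ρ i η : ℝ≥0∞) / (ρF Λ η : ℝ≥0∞)) η ≤ M := by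
  induction Λ using Finset.induction_on with
  | empty =>
    intro W ω _ _
    refine ⟨fun η _ => by rw [hrec.1]; exact one_pos, fun i _ => ⟨1, 1, one_pos, by simp, ?_⟩⟩
    intro η _
    simp [hrec.1, hnorm]
  | insert k Λ hk ih =>
    intro W ω hgood hdis
    have hkW : k ∉ W := fun h => (Finset.disjoint_left.1 hdis) (Finset.mem_insert_self _ _) h
    have hΛW : ∀ l ∈ Λ, l ∉ W := fun l hl h =>
      (Finset.disjoint_left.1 hdis) (Finset.mem_insert_of_mem hl) h
    obtain ⟨ih1, ih2⟩ := ih (insert k W) ω (by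
      intro l hl
      have h := hgood l (Finset.mem_insert_of_mem hl)
      have hlk : l ≠ k := fun h => hk (h ▸ hl)
      refine bSet_mono ?_ (fun _ _ _ => rfl) h
      intro a
      simp only [Finset.mem_union, Finset.mem_erase, Finset.mem_insert]
      rintro (h | h | h)
      · exact Or.inl ⟨h.1, Or.inr h.2⟩
      · exact Or.inl ⟨h ▸ hlk.symm, Or.inl h⟩
      · exact Or.inr h) (by
      rw [Finset.disjoint_left]
      intro l hl h
      rcases Finset.mem_insert.1 h with h | h
      · exact hk (h ▸ hl)
      · exact hΛW l hl h)
    obtain ⟨m', M', hm', hM', hb'⟩ := ih2 k (Finset.mem_insert_self _ _)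
    have hkb := mem_bSet_iff.1 (hgood k (Finset.mem_insert_self _ _))
    rw [Function.update_eq_self] at hkb
    have hag : ∀ η, Agree W ω η → Agree (insert k W) ω η := fun η h i hi =>
      h i (fun h' => hi (Finset.mem_insert_of_mem h'))
    have hag2 : ∀ η, Agree W ω η → Agree ((insert k Λ).erase k ∪ W) ω η := fun η h i hi =>
      h i (fun h' => hi (Finset.mem_union_right _ h'))
    have hval : ∀ η, Agree W ω η → (ρF (insert k Λ) η : ℝ≥0∞) =
        (ρ k η : ℝ≥0∞) / freeF lam {k} (fun η => (ρ k η : ℝ≥0∞) / (ρF Λ η : ℝ≥0∞)) η := by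
      intro η hη
      have hmem : (fun l : {x // x ∈ Λ} => η l.1) ∈ bSetF lam ρ Λ {k} η := by
        intro l
        have h := hgood l.1 (Finset.mem_insert_of_mem l.2)
        have hlk : l.1 ≠ k := fun h => hk (h ▸ l.2)
        simp only
        rw [hη l.1 (hΛW _ l.2)]
        refine bSet_mono ?_ ?_ h
        · intro a
          simp only [Finset.mem_union, Finset.mem_erase, Finset.mem_insert, Finset.mem_singleton]
          rintro (h | h)
          · exact Or.inl ⟨h.1, Or.inr h.2⟩
          · exact Or.inl ⟨h ▸ hlk.symm, Or.inl h⟩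
        · intro a ha _
          exact hη a (fun h => ha (Finset.mem_union_right _ h))
      rw [(hrec.2.2.2 Λ k hk η).2 _ hmem]
      unfold Rexpr
      rw [subst_self, hrec.2.1 k]
      have hp1 := ih1 η (hag η hη)
      have hp2 := hkb.1 η (hag2 η hη)
      exact div_aux (by simpa using hp1.ne') (by simp) (by simpa using hp2.ne') (by simp)
    constructor
    · intro η hη
      have hp2 := hkb.1 η (hag2 η hη)
      have h := hb' η (hag η hη)
      have : (0 : ℝ≥0∞) < ρF (insert k Λ) η := by
        rw [hval η hη]
        exact ENNReal.div_pos (by simpa using hp2.ne') (ne_top_of_le_ne_top hM'.ne h.2)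
      exact_mod_cast this
    · intro i hi
      have hik : i ≠ k := fun h => hkW (h ▸ hi)
      obtain ⟨m, M, hm, hM, hb⟩ := hkb.2 i hik
      refine ⟨m * m', M * M', ENNReal.mul_pos hm.ne' hm'.ne', ENNReal.mul_lt_top hM hM', ?_⟩
      intro η hη
      have hu : ∀ s, Agree W ω (Function.update η i s) := by
        intro s l hl
        have : l ≠ i := fun h => hl (h ▸ hi)
        simp [this, hη l hl]
      have hrat : Measurable (rat ρ i k) :=
        ((hmeas i).coe_nnreal_ennreal).div ((hmeas k).coe_nnreal_ennreal)
      have hratu : Measurable fun s => rat ρ i k (Function.update η i s) :=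
        hrat.comp (measurable_update η)
      have hpt : ∀ s, (ρ i (Function.update η i s) : ℝ≥0∞) /
          (ρF (insert k Λ) (Function.update η i s) : ℝ≥0∞) =
          rat ρ i k (Function.update η i s) * freeF lam {k}
            (fun η => (ρ k η : ℝ≥0∞) / (ρF Λ η : ℝ≥0∞)) (Function.update η i s) := by
        intro s
        have h := hb' _ (hag _ (hu s))
        have hp2 := hkb.1 _ (hag2 _ (hu s))
        rw [hval _ (hu s), rat, div_eq_mul_inv, ENNReal.inv_div, div_eq_mul_inv, div_eq_mul_inv]
        · ring
        · right; simp
        · right; simpa using hp2.ne'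
      have hbη := hb η (hag2 η hη)
      rw [freeF_single]
      rw [freeF_single] at hbη
      simp only [hpt]
      constructor
      · calc m * m' ≤ (∫⁻ s, rat ρ i k (Function.update η i s) ∂lam i) * m' := by
              gcongr; exact hbη.1
          _ = ∫⁻ s, rat ρ i k (Function.update η i s) * m' ∂lam i := by
              rw [lintegral_mul_const _ hratu]
          _ ≤ _ := by
              apply lintegral_mono; intro s
              have h := (hb' _ (hag _ (hu s))).1
              dsimp only; gcongr
      · calc _ ≤ ∫⁻ s, rat ρ i k (Function.update η i s) * M' ∂lam i := by
              apply lintegral_mono; intro s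
              have h := (hb' _ (hag _ (hu s))).2
              dsimp only; gcongr
          _ = (∫⁻ s, rat ρ i k (Function.update η i s) ∂lam i) * M' := by
              rw [lintegral_mul_const _ hratu]
          _ ≤ _ := by gcongr; exact hbη.2

theorem subst_update {Λ : Finset ι} {k : ι} (hk : k ∈ Λ) (x : {y // y ∈ Λ} → E)
    (ω : Config ι E) (s : E) : subst Λ x (Function.update ω k s) = subst Λ x ω := by
  funext l
  by_cases hl : l ∈ Λ
  · simp [subst, hl]
  · have : l ≠ k := fun h => hl (h ▸ hk)
    simp [subst, hl, this]

theorem subst_update_notMem {Λ : Finset ι} {k : ι} (hk : k ∉ Λ) (x : {y // y ∈ Λ} → E)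
    (ω : Config ι E) (s : E) :
    subst Λ x (Function.update ω k s) = Function.update (subst Λ x ω) k s := by
  funext l
  by_cases hl : l = k
  · subst hl; simp [subst, hk]
  · simp [subst, hl]

theorem agree_update {V : Finset ι} {k : ι} (hk : k ∈ V) (ω : Config ι E) (s : E) :
    Agree V ω (Function.update ω k s) := by
  intro l hl
  have : l ≠ k := fun h => hl (h ▸ hk)
  simp [this]

theorem single_factor {lam : ι → Measure E} [∀ i, IsProbabilityMeasure (lam i)]
    {ρ : ι → Config ι E → ℝ≥0}
    (hnorm : ∀ (i : ι) (ω : Config ι E), freeF lam {i} (fun η => (ρ i η : ℝ≥0∞)) ω = 1)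
    (h1 : H1 lam ρ)
    {ρF : Finset ι → Config ι E → ℝ≥0} (hrec : IsRec lam ρ ρF) (Δ : Finset ι) :
    ∀ k ∈ Δ, ∀ ω, (ρF Δ ω : ℝ≥0∞) = ρ k ω * freeF lam {k} (fun η => (ρF Δ η : ℝ≥0∞)) ω := by
  induction Δ using Finset.strongInduction with
  | H Δ ih =>
  intro k hk ω
  by_cases hs : ∃ j ∈ Δ, j ≠ k
  · obtain ⟨j, hj, hjk⟩ := hs
    have hkΛ : k ∈ Δ.erase j := Finset.mem_erase.2 ⟨hjk.symm, hk⟩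
    have ih' := ih (Δ.erase j) (Finset.erase_ssubset hj) k hkΛ
    obtain ⟨x, hx⟩ := bSetF_nonempty h1 (Finset.notMem_erase j Δ) ω
    have hval : ∀ η, x ∈ bSetF lam ρ (Δ.erase j) {j} η →
        (ρF Δ η : ℝ≥0∞) = (ρF (Δ.erase j) η : ℝ≥0∞) / Rexpr lam ρF (Δ.erase j) {j} x η := by
      intro η hη
      have := (hrec.2.2.2 (Δ.erase j) j (Finset.notMem_erase j Δ) η).2 x hη
      rwa [Finset.insert_erase hj] at this
    have hvu : ∀ s, (ρF Δ (Function.update ω k s) : ℝ≥0∞) =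
        (ρF (Δ.erase j) (Function.update ω k s) : ℝ≥0∞) *
          (Rexpr lam ρF (Δ.erase j) {j} x ω)⁻¹ := by
      intro s
      rw [hval _ (bSetF_congr (agree_update (Finset.mem_union_left _ hkΛ) ω s) hx)]
      unfold Rexpr
      rw [subst_update hkΛ, div_eq_mul_inv]
    have hm : Measurable fun s => (ρF (Δ.erase j) (Function.update ω k s) : ℝ≥0∞) :=
      ((hrec.2.2.1 _).coe_nnreal_ennreal).comp (measurable_update ω)
    rw [freeF_single]
    simp only [hvu]
    rw [lintegral_mul_const _ hm, hval ω hx, ih' ω, freeF_single, div_eq_mul_inv, mul_assoc]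
  · push Not at hs
    have : Δ = {k} := by
      ext a; simp only [Finset.mem_singleton]
      exact ⟨hs a, fun h => h ▸ hk⟩
    subst this
    rw [hrec.2.1, hnorm, mul_one]

/-- The normalisation `λ_i(ρ_{Λ∪i}/ρ_Λ) = 1`. -/
theorem ratio_norm {lam : ι → Measure E} [∀ i, IsProbabilityMeasure (lam i)]
    {ρ : ι → Config ι E → ℝ≥0} (hmeas : ∀ i, Measurable (ρ i))
    (hnorm : ∀ (i : ι) (ω : Config ι E), freeF lam {i} (fun η => (ρ i η : ℝ≥0∞)) ω = 1)
    (h1 : H1 lam ρ)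
    {ρF : Finset ι → Config ι E → ℝ≥0} (hrec : IsRec lam ρ ρF) (Λ : Finset ι)
    (i : ι) (hi : i ∉ Λ) (ω : Config ι E)
    (hpos : ∀ᵐ s ∂lam i, ρF Λ (Function.update ω i s) ≠ 0) :
    freeF lam {i} (fun η => (ρF (insert i Λ) η : ℝ≥0∞) / ρF Λ η) ω = 1 := by
  obtain ⟨x, hx⟩ := bSetF_nonempty h1 hi ω
  obtain ⟨hp, hb⟩ := good_bounds hmeas hnorm hrec Λ {i} (subst Λ x ω) (by
    intro k hk
    have := hx ⟨k, hk⟩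
    have h2 : subst Λ x ω k = x ⟨k, hk⟩ := by simp [subst, hk]
    rw [h2]
    refine bSet_mono (Finset.Subset.refl _) ?_ this
    intro l hl hlk
    have : l ∉ Λ := by
      intro h; apply hl; simp [h, hlk]
    simp [subst, this]) (by simpa using hi)
  obtain ⟨m, M, hm, hM, hb⟩ := hb i (by simp)
  have hb := hb _ (fun _ _ => rfl)
  set g := freeF lam {i} (fun η => (ρ i η : ℝ≥0∞) / (ρF Λ η : ℝ≥0∞)) (subst Λ x ω) with hg
  have hg0 : g ≠ 0 := (lt_of_lt_of_le hm hb.1).ne'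
  have hgt : g ≠ ⊤ := ne_top_of_le_ne_top hM.ne hb.2
  have hgu : ∀ s, freeF lam {i} (fun η => (ρ i η : ℝ≥0∞) / (ρF Λ η : ℝ≥0∞))
      (Function.update (subst Λ x ω) i s) = g := by
    intro s
    rw [hg, freeF_eq, lmarginal_update_of_mem lam (Finset.mem_singleton_self i)]
  have hm' : Measurable fun s => (ρ i (Function.update (subst Λ x ω) i s) : ℝ≥0∞) /
      ρF Λ (Function.update (subst Λ x ω) i s) :=
    (((hmeas i).coe_nnreal_ennreal).div ((hrec.2.2.1 Λ).coe_nnreal_ennreal)).comp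
      (measurable_update _)
  have hpt : ∀ᵐ s ∂lam i, (ρF (insert i Λ) (Function.update ω i s) : ℝ≥0∞) /
      ρF Λ (Function.update ω i s) = ((ρ i (Function.update (subst Λ x ω) i s) : ℝ≥0∞) /
      ρF Λ (Function.update (subst Λ x ω) i s)) * g⁻¹ := by
    filter_upwards [hpos] with s hs
    rw [(hrec.2.2.2 Λ i hi _).2 x (bSetF_congr
      (agree_update (Finset.mem_union_right _ (Finset.mem_singleton_self i)) ω s) hx)]
    unfold Rexpr
    rw [subst_update_notMem hi, hrec.2.1, hgu]
    have hp' := hp _ (agree_update (Finset.mem_singleton_self i) (subst Λ x ω) s)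
    have ha : (ρF Λ (Function.update ω i s) : ℝ≥0∞) ≠ 0 := by simpa using hs
    rw [div_eq_mul_inv, div_eq_mul_inv, mul_right_comm, ENNReal.mul_inv_cancel ha (by simp),
      one_mul, ENNReal.mul_inv, ENNReal.inv_div]
    · left; simp
    · right; simpa using hp'.ne'
    · right; exact hgt
    · right; exact hg0
  rw [freeF_single, lintegral_congr_ae hpt, lintegral_mul_const _ hm', ← freeF_single lam i
    (fun η => (ρ i η : ℝ≥0∞) / (ρF Λ η : ℝ≥0∞)), ← hg, ENNReal.mul_inv_cancel hg0 hgt]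

end Helpers

end GibbsSingleton

namespace GibbsSingleton

section Helpers2

variable {ι E : Type*} [DecidableEq ι] [MeasurableSpace E]

/-- The measure `μ λ_Λ`. -/
noncomputable def tau (lam : ι → Measure E) (Λ : Finset ι) (μ : Measure (Config ι E)) :
    Measure (Config ι E) :=
  (μ.prod (Measure.pi fun i : {x // x ∈ Λ} => lam i.1)).map
    (fun p => Function.updateFinset p.1 Λ p.2)

theorem lintegral_tau (lam : ι → Measure E) [∀ i, IsProbabilityMeasure (lam i)]
    (Λ : Finset ι) (μ : Measure (Config ι E)) [IsProbabilityMeasure μ]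
    {h : Config ι E → ℝ≥0∞} (hh : Measurable h) :
    ∫⁻ ω, h ω ∂(tau lam Λ μ) = ∫⁻ ω, freeF lam Λ h ω ∂μ := by
  have hm : Measurable (fun p : (Config ι E) × ({x // x ∈ Λ} → E) =>
    Function.updateFinset p.1 Λ p.2) := measurable_updateFinset'
  unfold tau
  have hc : Measurable (fun p : (Config ι E) × ({x // x ∈ Λ} → E) =>
    h (Function.updateFinset p.1 Λ p.2)) := hh.comp hm
  rw [lintegral_map hh hm, lintegral_prod _ hc.aemeasurable]
  rfl

theorem tau_apply (lam : ι → Measure E) [∀ i, IsProbabilityMeasure (lam i)]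
    (Λ : Finset ι) (μ : Measure (Config ι E)) [IsProbabilityMeasure μ]
    {A : Set (Config ι E)} (hA : MeasurableSet A) :
    tau lam Λ μ A = ∫⁻ ω, freeF lam Λ (A.indicator fun _ => 1) ω ∂μ := by
  rw [← lintegral_tau lam Λ μ (measurable_const.indicator hA), lintegral_indicator hA]
  simp

/-- Upgrade from sets to functions. -/
theorem upgrade {lam : ι → Measure E} [∀ i, IsProbabilityMeasure (lam i)]
    {Λ : Finset ι} {μ : Measure (Config ι E)} [IsProbabilityMeasure μ]
    {r : Config ι E → ℝ≥0} (hr : Measurable r)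
    (h : ∀ A : Set (Config ι E), MeasurableSet A →
      ∫⁻ ω, freeF lam Λ (fun η => (r η : ℝ≥0∞) * A.indicator (fun _ => 1) η) ω ∂μ = μ A)
    {φ : Config ι E → ℝ≥0∞} (hφ : Measurable φ) :
    ∫⁻ ω, (r ω : ℝ≥0∞) * φ ω ∂(tau lam Λ μ) = ∫⁻ ω, φ ω ∂μ := by
  have hr' : Measurable fun ω => (r ω : ℝ≥0∞) := hr.coe_nnreal_ennreal
  have : (tau lam Λ μ).withDensity (fun ω => (r ω : ℝ≥0∞)) = μ := by
    ext A hA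
    have hc : Measurable fun η => (r η : ℝ≥0∞) * A.indicator (fun _ => 1) η :=
      hr'.mul (measurable_const.indicator hA)
    rw [withDensity_apply _ hA, ← h A hA, ← lintegral_tau lam Λ μ hc, ← lintegral_indicator hA]
    congr 1
    funext ω
    by_cases hω : ω ∈ A <;> simp [hω]
  conv_rhs => rw [← this]
  rw [lintegral_withDensity_eq_lintegral_mul _ hr' hφ]
  rfl

theorem null_freeF {lam : ι → Measure E} [∀ i, IsProbabilityMeasure (lam i)]
    {Λ : Finset ι} {μ : Measure (Config ι E)} [IsProbabilityMeasure μ]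
    {A : Set (Config ι E)} (hA : MeasurableSet A) (h : tau lam Λ μ A = 0) :
    ∀ᵐ ω ∂μ, freeF lam Λ (A.indicator fun _ => 1) ω = 0 := by
  rw [tau_apply lam Λ μ hA, lintegral_eq_zero_iff
    (measurable_freeF lam (measurable_const.indicator hA))] at h
  exact h

theorem main_dir {lam : ι → Measure E} [∀ i, IsProbabilityMeasure (lam i)]
    {ρ : ι → Config ι E → ℝ≥0} (hmeas : ∀ i, Measurable (ρ i))
    (hnorm : ∀ (i : ι) (ω : Config ι E), freeF lam {i} (fun η => (ρ i η : ℝ≥0∞)) ω = 1)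
    (h1 : H1 lam ρ)
    {ρF : Finset ι → Config ι E → ℝ≥0} (hrec : IsRec lam ρ ρF)
    {μ : Measure (Config ι E)} [IsProbabilityMeasure μ]
    (hN : ∀ (V : Finset ι) (j : ι), j ∉ V →
      ∫⁻ ω, freeF lam {j} ((BSet lam ρ j V)ᶜ.indicator fun _ => 1) ω ∂μ = 0)
    (hS : ∀ (i : ι) (A : Set (Config ι E)), MeasurableSet A →
        ∫⁻ ω, freeF lam {i} (fun η => (ρ i η : ℝ≥0∞) * A.indicator (fun _ => 1) η) ω ∂μ = μ A)
    (Λ : Finset ι) :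
    (tau lam Λ μ ≪ μ) ∧ ∀ φ : Config ι E → ℝ≥0∞, Measurable φ →
      ∫⁻ ω, (ρF Λ ω : ℝ≥0∞) * φ ω ∂(tau lam Λ μ) = ∫⁻ ω, φ ω ∂μ := by
  have hmF : ∀ Λ, Measurable fun ω => (ρF Λ ω : ℝ≥0∞) :=
    fun Λ => (hrec.2.2.1 Λ).coe_nnreal_ennreal
  have hm1 : ∀ i, Measurable fun ω => (ρ i ω : ℝ≥0∞) :=
    fun i => (hmeas i).coe_nnreal_ennreal
  -- positivity of the single-site densities
  have hpos : ∀ i, tau lam {i} μ {ω | ρ i ω = 0} = 0 := by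
    intro i
    have hA : MeasurableSet {ω | ρ i ω = 0} := (hmeas i) (measurableSet_singleton 0)
    rw [tau_apply lam {i} μ hA, ← nonpos_iff_eq_zero, ← hN ∅ i (by simp)]
    refine lintegral_mono fun ω => lintegral_mono fun σ => ?_
    refine Set.indicator_le_indicator_of_subset ?_ (fun _ => zero_le) _
    intro ζ hζ hζB
    have hb := (mem_bSet_iff.1 hζB).1 ζ (by
      rw [Function.update_eq_self]; intro _ _; rfl)
    exact hb.ne' hζ
  have hac : ∀ i, tau lam {i} μ ≪ μ := by
    intro i
    refine Measure.AbsolutelyContinuous.mk fun A hA hμA => ?_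
    have h := upgrade (hmeas i) (hS i) (measurable_const.indicator hA :
      Measurable (A.indicator fun _ => (1 : ℝ≥0∞)))
    rw [lintegral_indicator hA] at h
    simp only [lintegral_const, Measure.restrict_apply_univ, one_mul, hμA] at h
    have hc : Measurable fun η => (ρ i η : ℝ≥0∞) * A.indicator (fun _ => 1) η :=
      (hm1 i).mul (measurable_const.indicator hA)
    rw [lintegral_eq_zero_iff hc] at h
    have h2 : ∀ᵐ ω ∂(tau lam {i} μ), ρ i ω ≠ 0 := by
      rw [ae_iff]; simpa using hpos i
    have h3 : ∀ᵐ ω ∂(tau lam {i} μ), ω ∉ A := by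
      filter_upwards [h, h2] with ω hω hω2 hωA
      simp [hωA] at hω
      exact hω2 hω
    rw [ae_iff] at h3
    simpa using h3
  induction Λ using Finset.induction_on with
  | empty =>
    have he : ∀ φ : Config ι E → ℝ≥0∞, Measurable φ →
        ∫⁻ ω, φ ω ∂(tau lam ∅ μ) = ∫⁻ ω, φ ω ∂μ := by
      intro φ hφ
      rw [lintegral_tau lam ∅ μ hφ, freeF_eq, lmarginal_empty]
    constructor
    · refine Measure.AbsolutelyContinuous.mk fun A hA hμA => ?_
      rw [tau_apply lam ∅ μ hA, freeF_eq, lmarginal_empty, lintegral_indicator hA]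
      simpa using hμA
    · intro φ hφ
      simp only [hrec.1, ENNReal.coe_one, one_mul]
      exact he φ hφ
  | insert i Λ hi ih =>
    obtain ⟨ihac, ihS⟩ := ih
    -- absolute continuity
    refine ⟨?_, ?_⟩
    · refine Measure.AbsolutelyContinuous.mk fun A hA hμA => ?_
      have hAm : Measurable (A.indicator fun _ => (1 : ℝ≥0∞)) := measurable_const.indicator hA
      rw [tau_apply lam _ μ hA, freeF_insert lam hi hAm,
        ← lintegral_tau lam Λ μ (measurable_freeF lam hAm)]
      rw [lintegral_eq_zero_iff (measurable_freeF lam hAm)]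
      exact ihac.ae_le (null_freeF hA (hac i hμA))
    · intro φ hφ
      -- positivity of `ρF Λ`
      have hZ : MeasurableSet {ω | ρF Λ ω = 0} := (hrec.2.2.1 Λ) (measurableSet_singleton 0)
      have hμZ : μ {ω | ρF Λ ω = 0} = 0 := by
        have h := ihS ({ω | ρF Λ ω = 0}.indicator fun _ => 1) (measurable_const.indicator hZ)
        rw [lintegral_indicator hZ] at h
        simp only [lintegral_const, Measure.restrict_apply_univ, one_mul] at h
        rw [← h, ← lintegral_zero (μ := tau lam Λ μ)]
        congr 1
        funext ω
        by_cases hω : ρF Λ ω = 0 <;> simp [hω]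
      have hτZ : ∀ᵐ ω ∂(tau lam Λ μ), ρF Λ ω ≠ 0 := by
        have := ihac hμZ
        rw [ae_iff]; simpa using this
      have hone : ∀ᵐ ω ∂μ,
          freeF lam {i} (fun η => (ρF (insert i Λ) η : ℝ≥0∞) / ρF Λ η) ω = 1 := by
        filter_upwards [null_freeF hZ (hac i hμZ)] with ω hω
        refine ratio_norm hmeas hnorm h1 hrec Λ i hi ω ?_
        have hc : Measurable fun s => {ω | ρF Λ ω = 0}.indicator (fun _ => (1 : ℝ≥0∞))
            (Function.update ω i s) :=
          (measurable_const.indicator hZ).comp (measurable_update ω)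
        rw [freeF_single, lintegral_eq_zero_iff hc] at hω
        filter_upwards [hω] with s hs hs0
        simp [hs0] at hs
      have hfac := single_factor hnorm h1 hrec (insert i Λ) i (Finset.mem_insert_self _ _)
      set e := freeF lam {i} (fun η => (ρF (insert i Λ) η : ℝ≥0∞)) with he
      have heu : ∀ ω s, e (Function.update ω i s) = e ω := by
        intro ω s
        rw [he, freeF_eq, lmarginal_update_of_mem lam (Finset.mem_singleton_self i)]
      have hrφ : Measurable fun ω => (ρF (insert i Λ) ω : ℝ≥0∞) * φ ω := (hmF _).mul hφ
      have hLrφ := measurable_freeF lam (Λ := {i}) hrφ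
      have hq : Measurable fun ω => (ρ i ω : ℝ≥0∞) / ρF Λ ω := (hm1 i).div (hmF Λ)
      rw [lintegral_tau lam _ μ hrφ, freeF_insert lam hi hrφ, ← lintegral_tau lam Λ μ hLrφ]
      set L := freeF lam {i} (fun ω => (ρF (insert i Λ) ω : ℝ≥0∞) * φ ω) with hL
      have hLu : ∀ ω s, L (Function.update ω i s) = L ω := by
        intro ω s
        rw [hL, freeF_eq, lmarginal_update_of_mem lam (Finset.mem_singleton_self i)]
      have hLe : ∀ ω, L ω = e ω * freeF lam {i} (fun η => (ρ i η : ℝ≥0∞) * φ η) ω := by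
        intro ω
        rw [hL, freeF_single, freeF_single, ← lintegral_const_mul]
        · congr 1
          funext s
          rw [hfac, heu]; ring
        · exact ((hm1 i).mul hφ).comp (measurable_update ω)
      have hge : ∀ ω, freeF lam {i} (fun η => (ρF (insert i Λ) η : ℝ≥0∞) / ρF Λ η) ω =
          freeF lam {i} (fun η => (ρ i η : ℝ≥0∞) / ρF Λ η) ω * e ω := by
        intro ω
        rw [freeF_single, freeF_single, ← lintegral_mul_const]
        · congr 1
          funext s
          rw [hfac, heu, div_eq_mul_inv, div_eq_mul_inv]; ring
        · exact hq.comp (measurable_update ω)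
      calc ∫⁻ ω, L ω ∂(tau lam Λ μ)
          = ∫⁻ ω, (ρF Λ ω : ℝ≥0∞) * ((ρF Λ ω : ℝ≥0∞)⁻¹ * L ω) ∂(tau lam Λ μ) := by
            refine lintegral_congr_ae ?_
            filter_upwards [hτZ] with ω hω
            rw [← mul_assoc, ENNReal.mul_inv_cancel (by simpa using hω) (by simp), one_mul]
        _ = ∫⁻ ω, (ρF Λ ω : ℝ≥0∞)⁻¹ * L ω ∂μ := ihS _ ((hmF Λ).inv.mul hLrφ)
        _ = ∫⁻ ω, (ρ i ω : ℝ≥0∞) * ((ρF Λ ω : ℝ≥0∞)⁻¹ * L ω) ∂(tau lam {i} μ) :=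
            (upgrade (hmeas i) (hS i) ((hmF Λ).inv.mul hLrφ)).symm
        _ = ∫⁻ ω, freeF lam {i} (fun ω => (ρ i ω : ℝ≥0∞) * ((ρF Λ ω : ℝ≥0∞)⁻¹ * L ω)) ω ∂μ :=
            lintegral_tau lam {i} μ ((hm1 i).mul ((hmF Λ).inv.mul hLrφ))
        _ = ∫⁻ ω, freeF lam {i} (fun η => (ρ i η : ℝ≥0∞) / ρF Λ η) ω * L ω ∂μ := by
            congr 1
            funext ω
            rw [freeF_single, freeF_single, ← lintegral_mul_const]
            · congr 1
              funext s
              rw [hLu, div_eq_mul_inv, mul_assoc]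
            · exact hq.comp (measurable_update ω)
        _ = ∫⁻ ω, freeF lam {i} (fun η => (ρ i η : ℝ≥0∞) * φ η) ω ∂μ := by
            refine lintegral_congr_ae ?_
            filter_upwards [hone] with ω hω
            rw [hLe, ← mul_assoc, ← hge, hω, one_mul]
        _ = ∫⁻ ω, (ρ i ω : ℝ≥0∞) * φ ω ∂(tau lam {i} μ) :=
            (lintegral_tau lam {i} μ ((hm1 i).mul hφ)).symm
        _ = ∫⁻ ω, φ ω ∂μ := upgrade (hmeas i) (hS i) hφ

end Helpers2

end GibbsSingleton

open GibbsSingleton MeasureTheory ProbabilityTheory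

/-- **Theorem 1 (III).**  Assume the `λ^i` are probability measures and let `{ρ_Λ}`
be the recursively constructed family.  For probability measures `μ` in the class `𝒩`
(those with `(μ λ_j)(B(j,V)ᶜ) = 0` for all finite `V` and `j ∉ V`), consistency with
the full specification `{ρ_Λ λ_Λ}` is equivalent to consistency with the singletons
`{ρ_i λ_i}`. -/
theorem consistency_iff_singleton_consistency
    {d : ℕ} (hd : 0 < d) {E : Type*} [MeasurableSpace E]
    (lam : (Fin d → ℤ) → Measure E) [∀ i, IsProbabilityMeasure (lam i)]
    (ρ : (Fin d → ℤ) → Config (Fin d → ℤ) E → ℝ≥0)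
    (hmeas : ∀ i, Measurable (ρ i))
    (hnorm : ∀ (i : Fin d → ℤ) (ω : Config (Fin d → ℤ) E),
      freeF lam {i} (fun η => (ρ i η : ℝ≥0∞)) ω = 1)
    (h1 : H1 lam ρ) (h2 : H2 lam ρ)
    (ρF : Finset (Fin d → ℤ) → Config (Fin d → ℤ) E → ℝ≥0)
    (hrec : IsRec lam ρ ρF)
    (μ : Measure (Config (Fin d → ℤ) E)) [IsProbabilityMeasure μ]
    (hN : ∀ (V : Finset (Fin d → ℤ)) (j : Fin d → ℤ), j ∉ V →
      ∫⁻ ω, freeF lam {j} ((BSet lam ρ j V)ᶜ.indicator fun _ => 1) ω ∂μ = 0) :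
    (∀ (Λ : Finset (Fin d → ℤ)) (A : Set (Config (Fin d → ℤ) E)), MeasurableSet A →
        ∫⁻ ω, freeF lam Λ (fun η => (ρF Λ η : ℝ≥0∞) * A.indicator (fun _ => 1) η) ω ∂μ = μ A)
      ↔
    (∀ (i : Fin d → ℤ) (A : Set (Config (Fin d → ℤ) E)), MeasurableSet A →
        ∫⁻ ω, freeF lam {i} (fun η => (ρ i η : ℝ≥0∞) * A.indicator (fun _ => 1) η) ω ∂μ = μ A) := by
  constructor
  · intro h i A hA
    have := h {i} A hA
    rwa [hrec.2.1 i] at this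
  · intro hS Λ A hA
    have hAm : Measurable (A.indicator fun _ => (1 : ℝ≥0∞)) := measurable_const.indicator hA
    have h := (main_dir hmeas hnorm h1 hrec hN hS Λ).2 _ hAm
    have hc : Measurable fun η => (ρF Λ η : ℝ≥0∞) * A.indicator (fun _ => 1) η :=
      (hrec.2.2.1 Λ).coe_nnreal_ennreal.mul hAm
    rw [lintegral_tau lam Λ μ hc, lintegral_indicator hA] at h
    simpa using h
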